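/- arXiv:1903.00186 — 4 statements merged into one kernel-verified Lean document; each statement's English description precedes it below -/
import Mathlib

section
/- Let V : ℝ^N → ℝ be differentiable, A a symmetric positive semi-definite N×N matrix, Δτ > 0, θ ∈ [0,1], and z_n, z_{n+1} ∈ ℝ^N. Set z_{n+θ} = θ z_{n+1} + (1-θ) z_n and suppose the denominator d = ∇V(z_{n+θ}) · (z_{n+1} - z_n) is nonzero. Define the discrete gradient ∇̄V = ((V(z_{n+1}) - V(z_n))/d) ∇V(z_{n+θ}). If z_{n+1} - z_n = -Δτ A ∇̄V, then V(z_{n+1}) - V(z_n) = -Δτ ∇̄V · A ∇̄V, and in particular V(z_{n+1}) ≤ V(z_n), regardless of the size of Δτ. -/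
open Matrix

/-- One step of the discrete gradient method
`z₁ - z₀ = -Δτ A ∇̄V(z₁, z₀)` with discrete gradient
`∇̄V = ((V z₁ - V z₀)/d) ∇V(z_θ)`, `z_θ = θ z₁ + (1-θ) z₀`,
`d = ∇V(z_θ) ⬝ (z₁ - z₀) ≠ 0`, satisfies the exact discrete energy decay
`V z₁ - V z₀ = -Δτ ∇̄V ⬝ A ∇̄V ≤ 0`, regardless of the size of `Δτ > 0`. -/
theorem discrete_gradient_decay {N : ℕ}
    (V : (Fin N → ℝ) → ℝ) (gradV : (Fin N → ℝ) → (Fin N → ℝ))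
    (hV : Differentiable ℝ V)
    (hgradV : ∀ z v, fderiv ℝ V z v = gradV z ⬝ᵥ v)
    (A : Matrix (Fin N) (Fin N) ℝ) (hA : A.PosSemidef)
    (Δτ : ℝ) (hΔτ : 0 < Δτ) (θ : ℝ) (hθ : θ ∈ Set.Icc (0 : ℝ) 1)
    (z0 z1 zθ : Fin N → ℝ) (hzθ : zθ = θ • z1 + (1 - θ) • z0)
    (d : ℝ) (hd : d = gradV zθ ⬝ᵥ (z1 - z0)) (hd0 : d ≠ 0)
    (Dbar : Fin N → ℝ) (hDbar : Dbar = ((V z1 - V z0) / d) • gradV zθ)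
    (hstep : z1 - z0 = -(Δτ • A.mulVec Dbar)) :
    V z1 - V z0 = -(Δτ * (Dbar ⬝ᵥ A.mulVec Dbar)) ∧ V z1 ≤ V z0 := by
  have h_chord : V z1 - V z0 = Dbar ⬝ᵥ (z1 - z0) := by
    rw [hDbar, smul_dotProduct, ← hd, smul_eq_mul, div_mul_cancel₀ _ hd0]
  have h_decay : V z1 - V z0 = -(Δτ * (Dbar ⬝ᵥ A.mulVec Dbar)) := by
    rw [h_chord, hstep, dotProduct_neg, dotProduct_smul, smul_eq_mul]
  have h_nonneg : 0 ≤ Dbar ⬝ᵥ A.mulVec Dbar := by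
    simpa using hA.dotProduct_mulVec_nonneg Dbar
  exact ⟨h_decay, by linarith [mul_nonneg hΔτ.le h_nonneg]⟩
end

section
/- Let H be an N_y × N_x matrix, R a symmetric positive definite N_y × N_y matrix, y ∈ ℝ^{N_y}, and set S(x) = (1/2)(Hx - y)ᵀ R⁻¹ (Hx - y). Let x¹, …, x^M ∈ ℝ^{N_x} with M ≥ 2, x̄ = (1/M)∑_j x^j, V({x^j}) = (M/2){S(x̄) + (1/M)∑_j S(x^j)}, P^{xx} = (1/(M-1))∑_j (x^j - x̄)(x^j - x̄)ᵀ, and P^{xh} = (1/(M-1))∑_j (x^j - x̄)(Hx^j - Hx̄)ᵀ. Then for each i = 1, …, M: P^{xx} ∇_{x^i} V({x^j}) = P^{xh} R⁻¹ ((1/2)(Hx^i + Hx̄) - y). In other words, for linear forward maps the derivative-free ensemble Kalman–Bucy filter dx^i = -P^{xh}R⁻¹((1/2)(h(x^i) + h̄) - y)dτ coincides with the gradient-flow ensemble Kalman–Bucy filter dx^i = -P^{xx}∇_{x^i}V dτ. -/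
open Matrix

/-- The gradient of `z ↦ (1/2)(Hz - y)ᵀ Q (Hz - y)` for symmetric `Q` is `Hᵀ Q (Hz - y)`. -/
lemma hasFDerivAt_half_weighted_sq {m n : Type*} [Fintype m] [Fintype n]
    (H : Matrix m n ℝ) (Q : Matrix m m ℝ) (hQ : Qᵀ = Q) (y : m → ℝ) (z : n → ℝ) :
    HasFDerivAt (fun z => (1 / 2 : ℝ) * ((H *ᵥ z - y) ⬝ᵥ Q *ᵥ (H *ᵥ z - y)))
      (dotProductBilin ℝ ℝ (Hᵀ *ᵥ (Q *ᵥ (H *ᵥ z - y)))).toContinuousLinearMap z := by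
  have hf : HasFDerivAt (fun z => H *ᵥ z - y) H.mulVecLin.toContinuousLinearMap z :=
    H.mulVecLin.toContinuousLinearMap.hasFDerivAt.sub_const y
  have hg : HasFDerivAt (fun z => Q *ᵥ (H *ᵥ z - y))
      (Q.mulVecLin.toContinuousLinearMap ∘L H.mulVecLin.toContinuousLinearMap) z :=
    Q.mulVecLin.toContinuousLinearMap.hasFDerivAt.comp z hf
  have hsum := (HasFDerivAt.fun_sum (u := Finset.univ) fun k _ =>
    (hasFDerivAt_pi'.1 hf k).mul (hasFDerivAt_pi'.1 hg k)).const_mul (1 / 2 : ℝ)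
  refine hsum.congr_fderiv ?_
  ext1 v
  have hsymm : (H *ᵥ z - y) ⬝ᵥ Q *ᵥ (H *ᵥ v) = Q *ᵥ (H *ᵥ z - y) ⬝ᵥ H *ᵥ v := by
    rw [dotProduct_mulVec, ← mulVec_transpose, hQ]
  have hadj : Hᵀ *ᵥ (Q *ᵥ (H *ᵥ z - y)) ⬝ᵥ v = Q *ᵥ (H *ᵥ z - y) ⬝ᵥ H *ᵥ v := by
    rw [mulVec_transpose, dotProduct_mulVec]
  have hexp : ∑ k, ((H *ᵥ z - y) k * (Q *ᵥ (H *ᵥ v)) k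
      + (Q *ᵥ (H *ᵥ z - y)) k * (H *ᵥ v) k) = 2 * (Q *ᵥ (H *ᵥ z - y) ⬝ᵥ H *ᵥ v) := by
    rw [Finset.sum_add_distrib, two_mul]
    exact congrArg (· + _) hsymm
  simp only [_root_.smul_apply, _root_.sum_apply,
    _root_.add_apply, ContinuousLinearMap.comp_apply,
    ContinuousLinearMap.proj_apply, LinearMap.coe_toContinuousLinearMap', mulVecLin_apply,
    smul_eq_mul, dotProductBilin_apply_apply]
  rw [hadj, hexp]
  ring

/-- The gradient, in the `i`-th particle, of the ensemble potential
`(M/2){S(x̄) + (1/M)∑ⱼ S(xʲ)}`, in terms of the gradients of `S` at `x̄` and at `xⁱ`. -/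
lemma hasFDerivAt_ensemble_potential {E : Type*} [NormedAddCommGroup E] [NormedSpace ℝ E]
    {M : ℕ} (S : E → ℝ) (x : Fin M → E) (i : Fin M) {L K : E →L[ℝ] ℝ}
    (hL : HasFDerivAt S L ((M : ℝ)⁻¹ • ∑ j, x j)) (hK : HasFDerivAt S K (x i)) :
    HasFDerivAt (fun ξ => ((M : ℝ) / 2) * (S ((M : ℝ)⁻¹ • ∑ j, Function.update x i ξ j)
      + (M : ℝ)⁻¹ * ∑ j, S (Function.update x i ξ j))) ((1 / 2 : ℝ) • (L + K)) (x i) := by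
  have hM : (M : ℝ) ≠ 0 := Nat.cast_ne_zero.2 (Fin.pos i).ne'
  have hx (ξ : E) : ∑ j, Function.update x i ξ j = ξ + ∑ j ∈ Finset.univ \ {i}, x j :=
    Finset.sum_update_of_mem (Finset.mem_univ i) x ξ
  have hSx (ξ : E) : ∑ j, S (Function.update x i ξ j)
      = S ξ + ∑ j ∈ Finset.univ \ {i}, S (x j) := by
    rw [← Finset.sum_update_of_mem (Finset.mem_univ i) (fun j => S (x j)) (S ξ)]
    exact Finset.sum_congr rfl fun j _ =>
      Function.apply_update (fun _ => S) x i ξ j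
  have hmean : ∑ j, x j = x i + ∑ j ∈ Finset.univ \ {i}, x j := by
    rw [← hx, Function.update_eq_self]
  simp only [hx, hSx]
  rw [hmean] at hL
  have hinner : HasFDerivAt (fun ξ => (M : ℝ)⁻¹ • (ξ + ∑ j ∈ Finset.univ \ {i}, x j))
      ((M : ℝ)⁻¹ • ContinuousLinearMap.id ℝ E) (x i) :=
    ((hasFDerivAt_id (x i)).add_const _).const_smul _
  refine (((hL.comp (x i) hinner).add
    ((hK.add_const _).const_mul (M : ℝ)⁻¹)).const_mul ((M : ℝ) / 2)).congr_fderiv ?_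
  ext v
  simp only [_root_.smul_apply, _root_.add_apply,
    ContinuousLinearMap.comp_apply, ContinuousLinearMap.id_apply, map_smul, smul_eq_mul]
  field_simp

/-- The empirical cross-covariance with a linear observable `H` is `P Hᵀ`. -/
lemma smul_sum_vecMulVec_mulVec_sub {ι m n : Type*} [Fintype ι] [Fintype n]
    (c : ℝ) (H : Matrix m n ℝ) (x : ι → n → ℝ) (a : n → ℝ) :
    c • ∑ j, vecMulVec (x j - a) (H *ᵥ x j - H *ᵥ a)
      = (c • ∑ j, vecMulVec (x j - a) (x j - a)) * Hᵀ := by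
  simp only [smul_mul, Matrix.sum_mul, ← mulVec_sub, vecMulVec_mul, vecMul_transpose]

/-- For the linear-Gaussian negative log-likelihood
`S(x) = (1/2)(Hx - y)ᵀ R⁻¹ (Hx - y)` and the ensemble Kalman–Bucy potential
`V({xʲ}) = (M/2){S(x̄) + (1/M)∑ⱼ S(xʲ)}`, the gradient-flow EnKBF coincides with
its derivative-free variant:
`P^{xx} ∇_{xⁱ}V = P^{xh} R⁻¹ ((1/2)(Hxⁱ + Hx̄) - y)` for every `i`. -/
theorem enkbf_gradient_free_equivalence {Nx Ny M : ℕ} (hM : 2 ≤ M)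
    (H : Matrix (Fin Ny) (Fin Nx) ℝ)
    (R : Matrix (Fin Ny) (Fin Ny) ℝ) (hR : R.PosDef)
    (y : Fin Ny → ℝ)
    (S : (Fin Nx → ℝ) → ℝ)
    (hS : S = fun x =>
      (1 / 2 : ℝ) * ((H.mulVec x - y) ⬝ᵥ R⁻¹.mulVec (H.mulVec x - y)))
    (x : Fin M → Fin Nx → ℝ)
    (xbar : Fin Nx → ℝ) (hxbar : xbar = (M : ℝ)⁻¹ • ∑ j, x j)
    (V : (Fin M → Fin Nx → ℝ) → ℝ)
    (hV : V = fun χ =>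
      ((M : ℝ) / 2) * (S ((M : ℝ)⁻¹ • ∑ j, χ j) + (M : ℝ)⁻¹ * ∑ j, S (χ j)))
    (Pxx : Matrix (Fin Nx) (Fin Nx) ℝ)
    (hPxx : Pxx = ((M : ℝ) - 1)⁻¹ • ∑ j, vecMulVec (x j - xbar) (x j - xbar))
    (Pxh : Matrix (Fin Nx) (Fin Ny) ℝ)
    (hPxh : Pxh = ((M : ℝ) - 1)⁻¹ •
      ∑ j, vecMulVec (x j - xbar) (H.mulVec (x j) - H.mulVec xbar))
    (gradVi : Fin M → Fin Nx → ℝ)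
    (hgradVi : ∀ i (v : Fin Nx → ℝ),
      fderiv ℝ (fun ξ => V (Function.update x i ξ)) (x i) v = gradVi i ⬝ᵥ v) :
    ∀ i, Pxx.mulVec (gradVi i)
      = Pxh.mulVec (R⁻¹.mulVec
          ((1 / 2 : ℝ) • (H.mulVec (x i) + H.mulVec xbar) - y)) := by
  intro i
  have hQ : (R⁻¹)ᵀ = R⁻¹ := by
    have hsymm : Rᵀ = R := by
      rw [← conjTranspose_eq_transpose_of_trivial, hR.isHermitian.eq]
    rw [transpose_nonsing_inv, hsymm]
  have hderiv (z : Fin Nx → ℝ) := hasFDerivAt_half_weighted_sq H R⁻¹ hQ y z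
  rw [← hS] at hderiv
  have hV' := hasFDerivAt_ensemble_potential S x i (hderiv _) (hderiv _)
  rw [← hxbar] at hV'
  have hgrad : gradVi i = Hᵀ *ᵥ (R⁻¹ *ᵥ ((1 / 2 : ℝ) • (H *ᵥ x i + H *ᵥ xbar) - y)) := by
    refine dotProduct_eq _ _ fun v => ?_
    rw [← hgradVi, hV, hV'.fderiv]
    have hmid : (1 / 2 : ℝ) • (H *ᵥ x i + H *ᵥ xbar) - y
        = (1 / 2 : ℝ) • ((H *ᵥ xbar - y) + (H *ᵥ x i - y)) := by
      module
    rw [hmid]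
    simp only [mulVec_smul, mulVec_add, smul_dotProduct, add_dotProduct,
      _root_.smul_apply, _root_.add_apply,
      LinearMap.coe_toContinuousLinearMap', dotProductBilin_apply_apply]
  rw [hgrad, hPxh, smul_sum_vecMulVec_mulVec_sub, ← hPxx, mulVec_mulVec]
end

section
/- Let m₀ ∈ ℝ, σ₀ > 0, r > 0, y ∈ ℝ. Define for τ ≥ 0 the time-dependent Kalman gain K_τ = σ₀τ/(σ₀τ + r), the mean m_τ = m₀ + K_τ(y - m₀), and the variance σ_τ = σ₀ - K_τσ₀. Then m and σ are differentiable on [0, ∞) with m_0 = m₀, σ_0 = σ₀, and they satisfy the mean-field ensemble Kalman–Bucy filter equations dσ_τ/dτ = -σ_τ²/r and dm_τ/dτ = -(σ_τ/r)(m_τ - y) for all τ ≥ 0. Moreover, at τ = 1 one has m_1 = m₀ + K(y - m₀) and σ_1 = σ₀ - Kσ₀ with K = σ₀/(σ₀ + r), i.e. the exact posterior mean and variance of the scalar linear-Gaussian inference problem. -/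
/-- The derivative of the Kalman gain `τ ↦ aτ/(aτ + r)`. -/
theorem hasDerivAt_kalmanGain {a r τ : ℝ} (h : a * τ + r ≠ 0) :
    HasDerivAt (fun t : ℝ => a * t / (a * t + r)) (a * r / (a * τ + r) ^ 2) τ := by
  have hnum : HasDerivAt (fun t : ℝ => a * t) a τ := by
    simpa using (hasDerivAt_id τ).const_mul a
  refine (hnum.fun_div (hnum.add_const r) h).congr_deriv ?_
  ring

/-- The time-dependent Kalman gain `K_τ = σ₀τ/(σ₀τ + r)` yields
`m_τ = m₀ + K_τ(y - m₀)` and `σ_τ = σ₀ - K_τσ₀` solving the mean-field ensemble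
Kalman–Bucy filter equations `σ' = -σ²/r`, `m' = -(σ/r)(m - y)` on `[0, ∞)`
with `m_0 = m₀`, `σ_0 = σ₀`, and at `τ = 1` one recovers the exact posterior
mean and variance of the scalar linear-Gaussian inference problem. -/
theorem enkbf_exact_solution_scalar (m₀ σ₀ r y : ℝ) (hσ₀ : 0 < σ₀) (hr : 0 < r)
    (Kf mf σf : ℝ → ℝ)
    (hKf : Kf = fun τ => σ₀ * τ / (σ₀ * τ + r))
    (hmf : mf = fun τ => m₀ + Kf τ * (y - m₀))
    (hσf : σf = fun τ => σ₀ - Kf τ * σ₀) :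
    mf 0 = m₀ ∧ σf 0 = σ₀ ∧
    (∀ τ : ℝ, 0 ≤ τ →
      HasDerivAt σf (-(σf τ) ^ 2 / r) τ ∧
      HasDerivAt mf (-(σf τ / r) * (mf τ - y)) τ) ∧
    mf 1 = m₀ + (σ₀ / (σ₀ + r)) * (y - m₀) ∧
    σf 1 = σ₀ - (σ₀ / (σ₀ + r)) * σ₀ := by
  subst hKf hmf hσf
  refine ⟨by simp, by simp, fun τ hτ => ?_, by simp, by simp⟩
  have hD : σ₀ * τ + r ≠ 0 := by positivity
  have hK := hasDerivAt_kalmanGain hD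
  constructor
  · refine ((hK.mul_const σ₀).const_sub σ₀).congr_deriv ?_
    field_simp
    ring
  · refine ((hK.mul_const (y - m₀)).const_add m₀).congr_deriv ?_
    field_simp
    ring
end

section
/- Let ψ : ℝ^{N_x} → (0, ∞) be continuously differentiable with ψ(-x) = ψ(x) for all x (so that ∇ψ(0) = 0), and let π* be a positive, continuously differentiable density. Let V({x^j}) = (1/M)∑_j { log((1/M)∑_l ψ(x^j - x^l)) - log π*(x^j) }. If all particles coincide at a single point, x¹ = x² = ⋯ = x^M = x*, then for every i, ∇_{x^i} V({x^j}) = -(1/M) ∇ log π*(x*). Consequently, the fully collapsed configuration (arising from the shrinkage parameter α = 1) is a stationary point of the particle flow Fokker–Planck dynamics dx^i = -M∇_{x^i}V dτ if and only if x* is a critical point of the posterior density π*. -/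
open Matrix

/-- The derivative of an even function vanishes at the origin. -/
theorem fderiv_zero_of_even {E : Type*} [NormedAddCommGroup E] [NormedSpace ℝ E] {f : E → ℝ}
    (hf : ∀ z, f (-z) = f z) (hd : DifferentiableAt ℝ f 0) : fderiv ℝ f 0 = 0 := by
  have h0 : HasFDerivAt f (fderiv ℝ f 0) (-0) := by simpa using hd.hasFDerivAt
  have h := h0.comp (0 : E) (hasFDerivAt_id (0 : E)).fun_neg
  have hcomp : f ∘ Neg.neg = f := funext hf
  rw [hcomp] at h
  ext v
  have hv := DFunLike.congr_fun (hd.hasFDerivAt.unique h) v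
  simp only [ContinuousLinearMap.comp_apply, _root_.neg_apply, map_neg,
    ContinuousLinearMap.id_apply] at hv
  rw [_root_.zero_apply]
  linarith

/-- The kernel interaction terms do not contribute to the gradient of the potential at a
collapsed configuration. -/
theorem hasFDerivAt_potential_update_const {E : Type*} [NormedAddCommGroup E] [NormedSpace ℝ E]
    {M : ℕ} {ψ p : E → ℝ} (hψpos : 0 < ψ 0) (hψeven : ∀ z, ψ (-z) = ψ z)
    (hψ : DifferentiableAt ℝ ψ 0) {a : E} (hp : DifferentiableAt ℝ p a) (i : Fin M) :
    HasFDerivAt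
      (fun ξ => (M : ℝ)⁻¹ * ∑ j,
        (Real.log ((M : ℝ)⁻¹ * ∑ l,
            ψ (Function.update (fun _ => a) i ξ j - Function.update (fun _ => a) i ξ l))
          - p (Function.update (fun _ => a) i ξ j)))
      (-(M : ℝ)⁻¹ • fderiv ℝ p a) a := by
  have hM : (M : ℝ) ≠ 0 := by exact_mod_cast i.pos.ne'
  have hu : Function.update (fun _ : Fin M => a) i a = fun _ => a := Function.update_eq_self i _
  have hχ (j : Fin M) : HasFDerivAt (fun ξ => Function.update (fun _ : Fin M => a) i ξ j)
      (if j = i then ContinuousLinearMap.id ℝ E else 0) a := by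
    by_cases h : j = i
    · subst h
      simpa using! hasFDerivAt_id a
    · simpa [h] using hasFDerivAt_const a a
  have hpair (j l : Fin M) : HasFDerivAt (fun ξ => ψ (Function.update (fun _ : Fin M => a) i ξ j
      - Function.update (fun _ : Fin M => a) i ξ l)) (0 : E →L[ℝ] ℝ) a := by
    have h0 : HasFDerivAt ψ (0 : E →L[ℝ] ℝ)
        (Function.update (fun _ : Fin M => a) i a j
          - Function.update (fun _ : Fin M => a) i a l) := by
      rw [hu, sub_self, ← fderiv_zero_of_even hψeven hψ]
      exact hψ.hasFDerivAt
    simpa using! h0.comp a ((hχ j).fun_sub (hχ l))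
  have hlog (j : Fin M) : HasFDerivAt (fun ξ => Real.log ((M : ℝ)⁻¹ * ∑ l,
      ψ (Function.update (fun _ : Fin M => a) i ξ j
        - Function.update (fun _ : Fin M => a) i ξ l))) (0 : E →L[ℝ] ℝ) a := by
    have h := (HasFDerivAt.fun_sum fun l (_ : l ∈ Finset.univ) => hpair j l).const_mul (M : ℝ)⁻¹
    simpa using h.log (by simp [hM, hψpos.ne'])
  have hpot (j : Fin M) : HasFDerivAt (fun ξ => p (Function.update (fun _ : Fin M => a) i ξ j))
      (if j = i then fderiv ℝ p a else 0) a := by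
    have h0 : HasFDerivAt p (fderiv ℝ p a) (Function.update (fun _ : Fin M => a) i a j) := by
      rw [hu]
      exact hp.hasFDerivAt
    have h := h0.comp a (hχ j)
    split_ifs at h ⊢ with hj <;> simpa using! h
  have h := (HasFDerivAt.fun_sum
    fun j (_ : j ∈ Finset.univ) => (hlog j).fun_sub (hpot j)).const_mul (M : ℝ)⁻¹
  simpa using h

/-- If all particles of the particle flow Fokker–Planck potential
`V({xʲ}) = (1/M)∑ⱼ{log((1/M)∑ₗψ(xʲ - xˡ)) - log π*(xʲ)}` coincide at a single
point `x*` (the fully collapsed configuration arising from shrinkage `α = 1`),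
then `∇_{xⁱ}V = -(1/M)∇log π*(x*)` for every `i`; consequently the collapsed
configuration is a stationary point of the dynamics `dxⁱ = -M∇_{xⁱ}V dτ` if and
only if `x*` is a critical point of the posterior density `π*`. -/
theorem collapsed_configuration_stationary {Nx M : ℕ} (hM : 1 ≤ M)
    (ψ : (Fin Nx → ℝ) → ℝ) (hψpos : ∀ z, 0 < ψ z)
    (hψeven : ∀ z, ψ (-z) = ψ z) (hψC1 : ContDiff ℝ 1 ψ)
    (gradψ : (Fin Nx → ℝ) → (Fin Nx → ℝ))
    (hgradψ : ∀ z v, fderiv ℝ ψ z v = gradψ z ⬝ᵥ v)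
    (πst : (Fin Nx → ℝ) → ℝ) (hπpos : ∀ z, 0 < πst z) (hπC1 : ContDiff ℝ 1 πst)
    (gradπ : (Fin Nx → ℝ) → (Fin Nx → ℝ))
    (hgradπ : ∀ z v, fderiv ℝ πst z v = gradπ z ⬝ᵥ v)
    (gradlogπ : (Fin Nx → ℝ) → (Fin Nx → ℝ))
    (hgradlogπ : ∀ z v,
      fderiv ℝ (fun w => Real.log (πst w)) z v = gradlogπ z ⬝ᵥ v)
    (xstar : Fin Nx → ℝ)
    (x : Fin M → Fin Nx → ℝ) (hx : x = fun _ => xstar)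
    (V : (Fin M → Fin Nx → ℝ) → ℝ)
    (hV : V = fun χ => (M : ℝ)⁻¹ *
      ∑ j, (Real.log ((M : ℝ)⁻¹ * ∑ l, ψ (χ j - χ l)) - Real.log (πst (χ j)))) :
    (∀ (i : Fin M) (v : Fin Nx → ℝ),
      fderiv ℝ (fun ξ => V (Function.update x i ξ)) (x i) v
        = (-(M : ℝ)⁻¹ • gradlogπ xstar) ⬝ᵥ v) ∧
    ((∀ i : Fin M, fderiv ℝ (fun ξ => V (Function.update x i ξ)) (x i) = 0) ↔
      gradπ xstar = 0) := by
  subst hx hV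
  have hψd : DifferentiableAt ℝ ψ 0 := hψC1.differentiable one_ne_zero 0
  have hπd : DifferentiableAt ℝ πst xstar := hπC1.differentiable one_ne_zero xstar
  have hM0 : (M : ℝ)⁻¹ ≠ 0 := inv_ne_zero (by exact_mod_cast (by omega : M ≠ 0))
  have hgrad (i : Fin M) := (hasFDerivAt_potential_update_const (hψpos 0) hψeven hψd
    (hπd.log (hπpos xstar).ne') i).fderiv
  refine ⟨fun i v => ?_, ?_⟩
  · rw [hgrad i, _root_.smul_apply, hgradlogπ, smul_dotProduct]
  · have hcrit : fderiv ℝ πst xstar = 0 ↔ gradπ xstar = 0 := by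
      rw [← dotProduct_eq_zero_iff, ContinuousLinearMap.ext_iff]
      simp [hgradπ]
    rw [← hcrit]
    simp only [hgrad, fderiv.log hπd (hπpos xstar).ne', smul_eq_zero, neg_eq_zero, hM0,
      inv_eq_zero, (hπpos xstar).ne', false_or]
    exact ⟨fun h => h ⟨0, hM⟩, fun h _ => h⟩
end
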